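/- Let p i denote the i-th prime and d j = ∏_{i=1}^{j} (1 − 1/(p i)). Then p (n+1) / (2 + ∑_{j=1}^{n} 1/(d j)) → e^{−γ} as n → ∞, where γ is the Euler–Mascheroni constant. In particular this limit is not 1, so the waiting-time form of the prime number theorem (Equation #1), which holds for the model sieve, fails for the real primes of the Sieve of Eratosthenes. -/

import Mathlib

open Filter Topology MeasureTheory Set

theorem tendsto_integral_mul_cexp_atTop (g : ℝ → ℂ) :
    Tendsto (fun x : ℝ => ∫ t : ℝ, g t * Complex.exp (Complex.I * t * x)) atTop (𝓝 0) := by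
  have h := Real.tendsto_integral_exp_smul_cocompact g
  have hw : Tendsto (fun x : ℝ => -x / (2 * Real.pi)) atTop (cocompact ℝ) := by
    refine Tendsto.mono_right ?_ atBot_le_cocompact
    exact (tendsto_neg_atTop_atBot).atBot_div_const (by positivity)
  refine (h.comp hw).congr fun x => ?_
  simp only [Function.comp]
  refine integral_congr_ae (Eventually.of_forall fun t => ?_)
  simp only [Circle.smul_def, Real.fourierChar_apply, smul_eq_mul]
  rw [mul_comm]
  congr 2
  push_cast
  field_simp

theorem integrable_mul_cexp_neg {f : ℝ → ℂ} {M : ℝ} (hf : Measurable f) (hM : ∀ u, ‖f u‖ ≤ M)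
    (h0 : ∀ u ≤ 0, f u = 0) {δ : ℝ} (hδ : 0 < δ) :
    Integrable (fun u : ℝ => f u * Complex.exp (-δ * u)) := by
  have h1 : IntegrableOn (fun u : ℝ => M * Real.exp (-δ * u)) (Ioi 0) :=
    (integrableOn_exp_mul_Ioi (by linarith) 0).const_mul M
  have h2 : IntegrableOn (fun u : ℝ => f u * Complex.exp (-δ * u)) (Ioi 0) := by
    refine h1.mono' (by fun_prop) (Eventually.of_forall fun u => ?_)
    rw [norm_mul, Complex.norm_exp]
    simp only [Complex.neg_re, Complex.mul_re, Complex.ofReal_re, Complex.ofReal_im, mul_zero,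
      sub_zero, Complex.neg_im]
    gcongr
    exact hM u
  refine (integrableOn_iff_integrable_of_support_subset fun u hu => ?_).1 h2
  by_contra hc
  exact hu (by simp [h0 u (not_lt.1 hc)])

theorem integral_mul_fourier_kernel {f : ℝ → ℂ} {M : ℝ} (hf : Measurable f)
    (hM : ∀ u, ‖f u‖ ≤ M) (h0 : ∀ u ≤ 0, f u = 0) {G : ℂ → ℂ}
    (hfG : ∀ z : ℂ, 0 < z.re → ∫ u : ℝ, f u * Complex.exp (-z * u) = G z)
    {k : ℝ → ℂ} (hk : Continuous k) (hks : HasCompactSupport k) {δ : ℝ} (hδ : 0 < δ) (x : ℝ) :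
    ∫ u : ℝ, f u * Complex.exp (-δ * u) *
        ∫ t : ℝ, k t * Complex.exp (Complex.I * t * (x - u : ℝ)) =
      ∫ t : ℝ, k t * G (δ + Complex.I * t) * Complex.exp (Complex.I * t * x) := by
  have hi := (integrable_mul_cexp_neg hf hM h0 hδ).mul_prod (hk.integrable_of_hasCompactSupport hks (μ := volume))
  have hi2 : Integrable (fun q : ℝ × ℝ => f q.1 * Complex.exp (-δ * q.1) *
      (k q.2 * Complex.exp (Complex.I * q.2 * (x - q.1 : ℝ)))) (volume.prod volume) := by
    refine hi.mono (by fun_prop) (Eventually.of_forall fun q => ?_)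
    simp only [norm_mul]
    rw [show Complex.I * (q.2 : ℂ) * ((x - q.1 : ℝ) : ℂ) = ((q.2 * (x - q.1) : ℝ) : ℂ) * Complex.I by
      push_cast; ring, Complex.norm_exp_ofReal_mul_I, mul_one]
  calc _ = ∫ u : ℝ, ∫ t : ℝ, f u * Complex.exp (-δ * u) *
        (k t * Complex.exp (Complex.I * t * (x - u : ℝ))) := by
        simp_rw [integral_const_mul]
    _ = ∫ t : ℝ, ∫ u : ℝ, f u * Complex.exp (-δ * u) *
        (k t * Complex.exp (Complex.I * t * (x - u : ℝ))) := integral_integral_swap hi2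
    _ = _ := by
        refine integral_congr_ae (Eventually.of_forall fun t => ?_)
        simp only
        rw [← hfG (δ + Complex.I * t) (by simpa using hδ), mul_right_comm, ← integral_const_mul]
        refine integral_congr_ae (Eventually.of_forall fun u => ?_)
        simp only
        have e : Complex.exp (-δ * u) * Complex.exp (Complex.I * t * (x - u : ℝ)) =
            Complex.exp (Complex.I * t * x) * Complex.exp (-(δ + Complex.I * t) * u) := by
          rw [← Complex.exp_add, ← Complex.exp_add]; congr 1; push_cast; ring
        linear_combination (f u * k t) * e

theorem integral_mul_fourier_kernel_boundary {f : ℝ → ℂ} {M : ℝ} (hf : Measurable f)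
    (hM : ∀ u, ‖f u‖ ≤ M) (h0 : ∀ u ≤ 0, f u = 0) {G : ℂ → ℂ}
    (hG : ContinuousOn G {z | 0 ≤ z.re})
    (hfG : ∀ z : ℂ, 0 < z.re → ∫ u : ℝ, f u * Complex.exp (-z * u) = G z)
    {k : ℝ → ℂ} (hk : Continuous k) (hks : HasCompactSupport k)
    (hK : Integrable (fun y : ℝ => ∫ t : ℝ, k t * Complex.exp (Complex.I * t * y))) (x : ℝ) :
    ∫ u : ℝ, f u * ∫ t : ℝ, k t * Complex.exp (Complex.I * t * (x - u : ℝ)) =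
      ∫ t : ℝ, k t * G (Complex.I * t) * Complex.exp (Complex.I * t * x) := by
  have hne : (𝓝[>] (0 : ℝ)).NeBot := inferInstance
  have hKx : Integrable fun u : ℝ => ∫ t : ℝ, k t * Complex.exp (Complex.I * t * (x - u : ℝ)) :=
    hK.comp_sub_left x
  have hL : Tendsto (fun δ : ℝ => ∫ u : ℝ, f u * Complex.exp (-δ * u) *
        ∫ t : ℝ, k t * Complex.exp (Complex.I * t * (x - u : ℝ))) (𝓝[>] 0)
      (𝓝 (∫ u : ℝ, f u * ∫ t : ℝ, k t * Complex.exp (Complex.I * t * (x - u : ℝ)))) := by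
    refine tendsto_integral_filter_of_dominated_convergence
      (fun u => M * ‖∫ t : ℝ, k t * Complex.exp (Complex.I * t * (x - u : ℝ))‖) ?_ ?_
      (hKx.norm.const_mul M) ?_
    · refine Eventually.of_forall fun δ => ?_
      exact AEStronglyMeasurable.mul (by fun_prop) hKx.aestronglyMeasurable
    · filter_upwards [self_mem_nhdsWithin] with δ hδ
      refine Eventually.of_forall fun u => ?_
      rw [norm_mul]
      gcongr
      by_cases hu : u ≤ 0
      · simp [h0 u hu, (norm_nonneg _).trans (hM 0)]
      · rw [norm_mul, Complex.norm_exp]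
        have : (-(δ : ℂ) * u).re ≤ 0 := by
          simp; exact mul_nonneg (le_of_lt hδ) (not_le.1 hu).le
        calc ‖f u‖ * Real.exp (-(δ : ℂ) * u).re ≤ M * 1 := by
              gcongr
              · exact (norm_nonneg _).trans (hM 0)
              · exact hM u
              · exact Real.exp_le_one_iff.2 this
          _ = M := mul_one M
    · refine Eventually.of_forall fun u => ?_
      have : Continuous fun δ : ℝ => f u * Complex.exp (-δ * u) *
        ∫ t : ℝ, k t * Complex.exp (Complex.I * t * (x - u : ℝ)) := by fun_prop
      have h := (this.tendsto 0).mono_left (nhdsWithin_le_nhds (s := Ioi 0))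
      simpa using h
  obtain ⟨B, hB⟩ : ∃ B, ∀ z ∈ (Icc (0:ℝ) 1 ×ˢ tsupport k), ‖G (z.1 + Complex.I * z.2)‖ ≤ B := by
    refine (isCompact_Icc.prod hks).exists_bound_of_continuousOn
      (f := fun z : ℝ × ℝ => G (z.1 + Complex.I * z.2)) ?_
    refine hG.comp (by fun_prop) ?_
    rintro ⟨a, b⟩ ⟨ha, -⟩
    simpa using ha.1
  have hR : Tendsto (fun δ : ℝ => ∫ t : ℝ, k t * G (δ + Complex.I * t) *
        Complex.exp (Complex.I * t * x)) (𝓝[>] 0)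
      (𝓝 (∫ t : ℝ, k t * G (Complex.I * t) * Complex.exp (Complex.I * t * x))) := by
    refine tendsto_integral_filter_of_dominated_convergence
      (fun t => ‖k t‖ * B) ?_ ?_
      ((hk.integrable_of_hasCompactSupport hks).norm.mul_const B) ?_
    · filter_upwards [self_mem_nhdsWithin] with δ hδ
      have : Continuous fun t : ℝ => G (δ + Complex.I * t) := by
        rw [← continuousOn_univ]
        refine hG.comp (by fun_prop) fun t _ => ?_
        simpa using le_of_lt hδ
      exact ((hk.mul this).mul (by fun_prop)).aestronglyMeasurable
    · filter_upwards [Ioc_mem_nhdsGT (zero_lt_one' ℝ)] with δ hδ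
      refine Eventually.of_forall fun t => ?_
      rw [norm_mul, norm_mul, show Complex.I * (t : ℂ) * x = ((t * x : ℝ) : ℂ) * Complex.I by
        push_cast; ring, Complex.norm_exp_ofReal_mul_I, mul_one]
      by_cases ht : t ∈ tsupport k
      · gcongr
        exact hB (δ, t) ⟨⟨hδ.1.le, hδ.2⟩, ht⟩
      · simp [image_eq_zero_of_notMem_tsupport ht]
    · refine Eventually.of_forall fun t => ?_
      have h1 : Tendsto (fun δ : ℝ => G (δ + Complex.I * t)) (𝓝[>] 0) (𝓝 (G (Complex.I * t))) := by
        have h2 : ContinuousWithinAt G {z | 0 ≤ z.re} (Complex.I * t) := hG _ (by simp)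
        refine h2.tendsto.comp (tendsto_nhdsWithin_iff.2 ⟨?_, ?_⟩)
        · have : Continuous fun δ : ℝ => (δ : ℂ) + Complex.I * t := by fun_prop
          simpa using (this.tendsto 0).mono_left (nhdsWithin_le_nhds (s := Ioi 0))
        · filter_upwards [self_mem_nhdsWithin] with δ hδ
          simpa using le_of_lt hδ
      exact (h1.const_mul (k t)).mul_const _
  refine tendsto_nhds_unique hL (hR.congr' ?_)
  filter_upwards [self_mem_nhdsWithin] with δ hδ
  exact (integral_mul_fourier_kernel hf hM h0 hfG hk hks hδ x).symm

theorem tendsto_integral_mul_fourier_kernel {f : ℝ → ℂ} {M : ℝ} (hf : Measurable f)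
    (hM : ∀ u, ‖f u‖ ≤ M) (h0 : ∀ u ≤ 0, f u = 0) {G : ℂ → ℂ}
    (hG : ContinuousOn G {z | 0 ≤ z.re})
    (hfG : ∀ z : ℂ, 0 < z.re → ∫ u : ℝ, f u * Complex.exp (-z * u) = G z)
    {k : ℝ → ℂ} (hk : Continuous k) (hks : HasCompactSupport k)
    (hK : Integrable (fun y : ℝ => ∫ t : ℝ, k t * Complex.exp (Complex.I * t * y))) :
    Tendsto (fun x : ℝ => ∫ u : ℝ, f u *
      ∫ t : ℝ, k t * Complex.exp (Complex.I * t * (x - u : ℝ))) atTop (𝓝 0) := by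
  simp_rw [integral_mul_fourier_kernel_boundary hf hM h0 hG hfG hk hks hK]
  exact tendsto_integral_mul_cexp_atTop _

/-- The tent function on `[-1, 1]`, the Fourier transform of the Fejér kernel. -/
noncomputable def tent (t : ℝ) : ℝ := max 0 (1 - |t|)

/-- The Fejér kernel on the real line (up to normalisation). -/
noncomputable def fejer (y : ℝ) : ℝ := if y = 0 then 1 else 2 * (1 - Real.cos y) / y ^ 2

theorem continuous_tent : Continuous tent := by unfold tent; fun_prop

theorem tent_eq_zero {t : ℝ} (ht : 1 ≤ |t|) : tent t = 0 := max_eq_left (by linarith)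

theorem integral_one_sub_mul_cexp {c : ℂ} (hc : c ≠ 0) :
    ∫ t in (0 : ℝ)..1, (1 - t) * Complex.exp (c * t) = (Complex.exp c - 1 - c) / c ^ 2 := by
  have hd : ∀ t : ℝ, HasDerivAt
      (fun t : ℝ => (1 - t) * Complex.exp (c * t) / c + Complex.exp (c * t) / c ^ 2)
      ((1 - t) * Complex.exp (c * t)) t := by
    intro t
    have h1 : HasDerivAt (fun t : ℝ => (t : ℂ)) 1 t := Complex.ofRealCLM.hasDerivAt
    have h2 := (h1.const_mul c).cexp
    convert! (((h1.const_sub 1).mul h2).div_const c).add (h2.div_const (c ^ 2)) using 1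
    field_simp
    ring
  rw [intervalIntegral.integral_eq_sub_of_hasDerivAt (fun t _ => hd t)
    (Continuous.intervalIntegrable (by fun_prop) _ _)]
  simp
  field_simp
  ring

theorem integral_tent_mul (g : ℝ → ℂ) (hg : Continuous g) :
    ∫ t, (tent t : ℂ) * g t =
      (∫ t in (0 : ℝ)..1, (1 - t) * g t) + ∫ t in (0 : ℝ)..1, (1 - t) * g (-t) := by
  have hc : Continuous fun t => (tent t : ℂ) * g t := by
    have := continuous_tent; fun_prop
  have h1 : ∫ t, (tent t : ℂ) * g t = ∫ t in (-1 : ℝ)..1, (tent t : ℂ) * g t := by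
    rw [intervalIntegral.integral_eq_integral_of_support_subset]
    intro t ht
    by_contra hn
    refine ht ?_
    rw [Set.mem_Ioc, not_and_or] at hn
    have : 1 ≤ |t| := by
      rcases hn with h | h
      · rw [le_abs]; right; linarith
      · rw [le_abs]; left; linarith
    simp [tent_eq_zero this]
  have h2 : ∫ t in (-1 : ℝ)..0, (tent t : ℂ) * g t = ∫ t in (0 : ℝ)..1, (1 - t) * g (-t) := by
    have := intervalIntegral.integral_comp_neg (a := 0) (b := 1) (fun t => (tent t : ℂ) * g t)
    rw [neg_zero] at this
    rw [← this]
    refine intervalIntegral.integral_congr fun t ht => ?_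
    rw [uIcc_of_le zero_le_one] at ht
    simp only [tent, abs_neg, abs_of_nonneg ht.1]
    rw [max_eq_right (by linarith [ht.2])]
    push_cast; ring
  have h3 : ∫ t in (0 : ℝ)..1, (tent t : ℂ) * g t = ∫ t in (0 : ℝ)..1, (1 - t) * g t := by
    refine intervalIntegral.integral_congr fun t ht => ?_
    rw [uIcc_of_le zero_le_one] at ht
    simp only [tent, abs_of_nonneg ht.1]
    rw [max_eq_right (by linarith [ht.2])]
    push_cast; ring
  rw [h1, ← intervalIntegral.integral_add_adjacent_intervals (b := 0) (hc.intervalIntegrable _ _)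
    (hc.intervalIntegrable _ _), h2, h3, add_comm]

theorem integral_tent_mul_cexp (y : ℝ) :
    ∫ t : ℝ, (tent t : ℂ) * Complex.exp (Complex.I * t * y) = fejer y := by
  rw [integral_tent_mul (fun t : ℝ => Complex.exp (Complex.I * t * y)) (by fun_prop)]
  rcases eq_or_ne y 0 with rfl | hy
  · have h : ∫ t in (0 : ℝ)..1, (1 - (t : ℂ)) = 1 / 2 := by
      rw [intervalIntegral.integral_sub (by simp)
        (Continuous.intervalIntegrable (by fun_prop) _ _)]
      have : ∫ t in (0 : ℝ)..1, (t : ℂ) = ((∫ t in (0 : ℝ)..1, t : ℝ) : ℂ) :=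
        intervalIntegral.integral_ofReal
      rw [this]
      simp
      norm_num
    simp [h, fejer]
    norm_num
  · have hc : Complex.I * y ≠ 0 := by simp [hy]
    have e1 := integral_one_sub_mul_cexp hc
    have e2 := integral_one_sub_mul_cexp (neg_ne_zero.2 hc)
    have e3 : ∀ t : ℝ, Complex.exp (Complex.I * t * y) = Complex.exp (Complex.I * y * t) :=
      fun t => by congr 1; ring
    have e4 : ∀ t : ℝ, Complex.exp (Complex.I * (-t : ℝ) * y) = Complex.exp (-(Complex.I * y) * t) :=
      fun t => by congr 1; push_cast; ring
    simp_rw [e4, e3, e1, e2]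
    have e5 : Complex.exp (Complex.I * y) + Complex.exp (-(Complex.I * y)) = 2 * Complex.cos y := by
      rw [Complex.two_cos]; congr 2 <;> ring
    have hy' : (y : ℂ) ≠ 0 := by exact_mod_cast hy
    simp only [fejer, hy, if_false]
    push_cast
    have e6 : (Complex.I * y) ^ 2 = - y ^ 2 := by rw [mul_pow, Complex.I_sq]; ring
    rw [neg_sq, e6]
    field_simp
    linear_combination -e5

theorem fejer_nonneg (y : ℝ) : 0 ≤ fejer y := by
  unfold fejer
  split_ifs
  · exact zero_le_one
  · have := Real.cos_le_one y
    exact div_nonneg (by linarith) (by positivity)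

theorem fejer_le (y : ℝ) : fejer y ≤ 8 * (1 + y ^ 2)⁻¹ := by
  unfold fejer
  split_ifs with h
  · subst h; norm_num
  · rw [← div_eq_mul_inv, div_le_div_iff₀ (by positivity) (by positivity)]
    have h1 := Real.neg_one_le_cos y
    have h2 := Real.one_sub_sq_div_two_le_cos (x := y)
    nlinarith [sq_nonneg y]

theorem measurable_fejer : Measurable fejer := by
  unfold fejer
  exact Measurable.ite (measurableSet_singleton 0) measurable_const (by fun_prop)

theorem integrable_fejer : Integrable fejer := by
  refine (integrable_inv_one_add_sq.const_mul 8).mono' measurable_fejer.aestronglyMeasurable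
    (Eventually.of_forall fun y => ?_)
  rw [Real.norm_of_nonneg (fejer_nonneg y)]
  exact fejer_le y

theorem integral_fejer_pos : 0 < ∫ y, fejer y := by
  rw [integral_pos_iff_support_of_nonneg fejer_nonneg integrable_fejer]
  refine lt_of_lt_of_le ?_ (measure_mono (s := Ioo 0 1) ?_)
  · simp
  · intro y hy
    have h0 : y ≠ 0 := hy.1.ne'
    have : Real.cos y < 1 := by
      rw [← Real.cos_zero]
      exact Real.cos_lt_cos_of_nonneg_of_le_pi le_rfl (by linarith [hy.2, Real.pi_gt_three]) hy.1
    have : 0 < fejer y := by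
      simp only [fejer, h0, if_false]
      have := hy.1
      exact div_pos (by linarith) (by positivity)
    exact this.ne'

theorem integral_tent_div_mul_cexp {r : ℝ} (hr : 0 < r) (y : ℝ) :
    ∫ t : ℝ, (tent (t / r) : ℂ) * Complex.exp (Complex.I * t * y) = (r * fejer (r * y) : ℝ) := by
  have := Measure.integral_comp_div
    (fun t : ℝ => (tent t : ℂ) * Complex.exp (Complex.I * t * (r * y : ℝ))) r
  rw [integral_tent_mul_cexp, abs_of_pos hr] at this
  push_cast
  rw [Complex.real_smul] at this
  rw [← this]
  refine integral_congr_ae (Eventually.of_forall fun t => ?_)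
  simp only
  congr 2
  push_cast
  have : (r : ℂ) ≠ 0 := by exact_mod_cast hr.ne'
  field_simp

theorem tendsto_integral_comp_mul_fejer {f : ℝ → ℝ} {M : ℝ} (hf : Measurable f)
    (hM : ∀ u, |f u| ≤ M) (h0 : ∀ u ≤ 0, f u = 0) {G : ℂ → ℂ}
    (hG : ContinuousOn G {z | 0 ≤ z.re})
    (hfG : ∀ z : ℂ, 0 < z.re → ∫ u : ℝ, f u * Complex.exp (-z * u) = G z)
    {r : ℝ} (hr : 0 < r) :
    Tendsto (fun x : ℝ => ∫ v : ℝ, f (x - v / r) * fejer v) atTop (𝓝 0) := by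
  have hk : Continuous fun t : ℝ => (tent (t / r) : ℂ) := by
    have := continuous_tent; fun_prop
  have hks : HasCompactSupport fun t : ℝ => (tent (t / r) : ℂ) := by
    refine HasCompactSupport.of_support_subset_isCompact (isCompact_Icc (a := -r) (b := r)) ?_
    intro t ht
    rw [mem_Icc, ← abs_le]
    by_contra hc
    refine ht ?_
    have : 1 ≤ |t / r| := by
      rw [abs_div, abs_of_pos hr, one_le_div hr]; exact (not_le.1 hc).le
    simp [tent_eq_zero this]
  have h := tendsto_integral_mul_fourier_kernel (f := fun u => (f u : ℂ)) (by fun_prop)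
    (by simpa using hM) (fun u hu => by simp [h0 u hu]) hG hfG hk hks ?_
  · simp_rw [integral_tent_div_mul_cexp hr, ← Complex.ofReal_mul, integral_complex_ofReal] at h
    have h' := (Complex.continuous_re.tendsto 0).comp h
    simp only [Function.comp_def, Complex.ofReal_re, Complex.zero_re] at h'
    refine h'.congr fun x => ?_
    have e1 := integral_sub_left_eq_self (fun u => f u * (r * fejer (r * (x - u)))) volume x
    have e2 := Measure.integral_comp_div (fun u => f (x - u) * (r * fejer (r * (x - (x - u))))) r
    rw [← e1]
    rw [abs_of_pos hr, smul_eq_mul, ← inv_mul_eq_iff_eq_mul₀ hr.ne'] at e2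
    rw [← e2, ← integral_const_mul]
    refine integral_congr_ae (Eventually.of_forall fun v => ?_)
    simp only [sub_sub_cancel]
    rw [mul_div_cancel₀ _ hr.ne']
    field_simp
  · simp_rw [integral_tent_div_mul_cexp hr]
    exact ((integrable_fejer.comp_mul_left' hr.ne').const_mul r).ofReal

theorem le_integral_mul_fejer {g : ℝ → ℝ} {M c V : ℝ} (hg : Measurable g) (hM : ∀ v, |g v| ≤ M)
    (hc : ∀ v ∈ Ioc (-V) V, c ≤ g v) :
    c * (∫ v in Ioc (-V) V, fejer v) - M * ((∫ v, fejer v) - ∫ v in Ioc (-V) V, fejer v) ≤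
      ∫ v, g v * fejer v := by
  have hi : Integrable fun v => g v * fejer v :=
    integrable_fejer.bdd_mul hg.aestronglyMeasurable (Eventually.of_forall hM)
  rw [← integral_add_compl (measurableSet_Ioc (a := -V) (b := V)) hi,
    ← integral_add_compl (measurableSet_Ioc (a := -V) (b := V)) integrable_fejer,
    add_sub_cancel_left, sub_eq_add_neg, ← neg_mul, ← integral_const_mul, ← integral_const_mul]
  refine add_le_add ?_ ?_
  · refine setIntegral_mono_on (integrable_fejer.const_mul c).integrableOn hi.integrableOn
      measurableSet_Ioc fun v hv => ?_
    exact mul_le_mul_of_nonneg_right (hc v hv) (fejer_nonneg v)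
  · refine setIntegral_mono (integrable_fejer.const_mul _).integrableOn hi.integrableOn fun v => ?_
    exact mul_le_mul_of_nonneg_right (abs_le.1 (hM v)).1 (fejer_nonneg v)

/-- A Tauberian theorem of Wiener–Ikehara type: a bounded `a` with `a u * exp u` monotone tends to
`1` provided that the Laplace transform of `a - 1` extends continuously to the imaginary axis. -/
theorem tendsto_one_of_laplace_continuousOn {a : ℝ → ℝ} {M : ℝ}
    (ha : Monotone fun u => a u * Real.exp u) (hM : ∀ u, |a u - 1| ≤ M)
    {G : ℂ → ℂ} (hG : ContinuousOn G {z | 0 ≤ z.re})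
    (hfG : ∀ z : ℂ, 0 < z.re →
      ∫ u : ℝ in Ioi 0, ((a u - 1 : ℝ) : ℂ) * Complex.exp (-z * u) = G z) :
    Tendsto a atTop (𝓝 1) := by
  have hM0 : 0 ≤ M := (abs_nonneg _).trans (hM 0)
  have ham : Measurable a := by
    have : a = fun u => (a u * Real.exp u) * Real.exp (-u) := by
      funext u; rw [mul_assoc, ← Real.exp_add]; simp
    rw [this]
    exact ha.measurable.mul (by fun_prop)
  set f : ℝ → ℝ := (Ioi 0).indicator fun u => a u - 1 with hf
  have hfm : Measurable f := (ham.sub_const 1).indicator measurableSet_Ioi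
  have hfM : ∀ u, |f u| ≤ M := by
    intro u
    by_cases hu : u ∈ Ioi (0 : ℝ)
    · simpa [hf, indicator_of_mem hu] using hM u
    · simpa [hf, indicator_of_notMem hu] using hM0
  have hf0 : ∀ u ≤ 0, f u = 0 := fun u hu => indicator_of_notMem (by simpa using hu) _
  have hfG' : ∀ z : ℂ, 0 < z.re → ∫ u : ℝ, f u * Complex.exp (-z * u) = G z := by
    intro z hz
    rw [← hfG z hz, ← integral_indicator measurableSet_Ioi]
    refine integral_congr_ae (Eventually.of_forall fun u => ?_)
    by_cases hu : u ∈ Ioi (0 : ℝ)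
    · simp [hf, indicator_of_mem hu]
    · simp [hf, indicator_of_notMem hu]
  set I := ∫ v, fejer v
  have hI : 0 < I := integral_fejer_pos
  set J : ℕ → ℝ := fun n => ∫ v in Ioc (-(n : ℝ)) n, fejer v with hJ
  have hJI : Tendsto J atTop (𝓝 I) := by
    have := intervalIntegral_tendsto_integral integrable_fejer
      (tendsto_neg_atTop_atBot.comp (tendsto_natCast_atTop_atTop (R := ℝ)))
      (tendsto_natCast_atTop_atTop (R := ℝ))
    refine this.congr fun n => ?_
    simp only [Function.comp, hJ]
    rw [intervalIntegral.integral_of_le (by linarith [n.cast_nonneg (α := ℝ)])]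
  set e : ℕ → ℝ := fun n => (M * (I - J n) + 1 / n) / J n with he
  have he0 : Tendsto e atTop (𝓝 0) := by
    have h1 : Tendsto (fun n : ℕ => 1 / (n : ℝ)) atTop (𝓝 0) := tendsto_one_div_atTop_nhds_zero_nat
    have := (((hJI.const_sub I).const_mul M).add h1).div hJI hI.ne'
    simpa [he, Pi.div_def] using this
  have hexp : ∀ c : ℝ, Tendsto (fun n : ℕ => Real.exp (c / n)) atTop (𝓝 1) := by
    intro c
    have := (Real.continuous_exp.tendsto 0).comp (tendsto_const_div_atTop_nhds_zero_nat c)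
    simpa [Function.comp_def] using this
  have hup : Tendsto (fun n : ℕ => Real.exp (2 / n) * (1 + e n)) atTop (𝓝 1) := by
    simpa using (hexp 2).mul (he0.const_add 1)
  have hlow : Tendsto (fun n : ℕ => Real.exp (-2 / n) * (1 - e n)) atTop (𝓝 1) := by
    simpa using (hexp (-2)).mul (he0.const_sub 1)
  have hloc : ∀ n : ℕ, 0 < n → ∀ x v : ℝ, 1 / (n : ℝ) < x → v ∈ Ioc (-(n : ℝ)) n →
      f (x - v / (n : ℝ) ^ 2) = a (x - v / (n : ℝ) ^ 2) - 1 ∧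
      x - 1 / n ≤ x - v / (n : ℝ) ^ 2 ∧ x - v / (n : ℝ) ^ 2 ≤ x + 1 / n := by
    intro n hn x v hx hv
    have hn' : (0 : ℝ) < n := by exact_mod_cast hn
    have h1 : v / (n : ℝ) ^ 2 ≤ 1 / n := by
      rw [div_le_div_iff₀ (by positivity) hn']; nlinarith [hv.2]
    have h2 : -(1 / n) ≤ v / (n : ℝ) ^ 2 := by
      rw [← neg_div, div_le_div_iff₀ hn' (by positivity)]; nlinarith [hv.1]
    refine ⟨indicator_of_mem (by simp only [mem_Ioi]; linarith) _, by linarith, by linarith⟩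
  have hcmp : ∀ y z : ℝ, y ≤ z → a y ≤ a z * Real.exp (z - y) := by
    intro y z h
    have h1 := ha h
    simp only at h1
    rw [Real.exp_sub, ← mul_div_assoc, le_div_iff₀ (Real.exp_pos y)]
    exact h1
  have ha0 : ∀ u, 0 ≤ a u := by
    by_contra hc
    push Not at hc
    obtain ⟨u, hu⟩ := hc
    obtain ⟨y, hy⟩ : ∃ y : ℝ, (M + 1) / (-a u) < Real.exp (u - y) :=
      ⟨u - ((M + 1) / (-a u)), by rw [sub_sub_cancel]; linarith [Real.add_one_le_exp ((M + 1) / (-a u))]⟩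
    rw [div_lt_iff₀ (by linarith)] at hy
    have hyu : y ≤ u := by
      by_contra h
      have : Real.exp (u - y) < 1 := Real.exp_lt_one_iff.2 (by linarith [not_le.1 h])
      have h3 := (abs_le.1 (hM u)).1
      nlinarith
    have h1 := hcmp y u hyu
    have h2 := (abs_le.1 (hM y)).1
    nlinarith
  have hev : ∀ n : ℕ, 0 < n → ∀ᶠ x : ℝ in atTop,
      |∫ v : ℝ, f (x - v / (n : ℝ) ^ 2) * fejer v| ≤ 1 / n := by
    intro n hn
    have h := tendsto_integral_comp_mul_fejer hfm hfM hf0 hG hfG' (r := (n : ℝ) ^ 2) (by positivity)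
    have hpos : (0 : ℝ) < 1 / n := by positivity
    filter_upwards [(Metric.tendsto_nhds.1 h) _ hpos] with x hx
    rw [Real.dist_eq, sub_zero] at hx
    exact hx.le
  have hJpos : ∀ᶠ n : ℕ in atTop, 0 < J n := hJI.eventually (lt_mem_nhds hI)
  have key_up : ∀ n : ℕ, 0 < n → 0 < J n → ∀ᶠ z : ℝ in atTop,
      a z ≤ Real.exp (2 / n) * (1 + e n) := by
    intro n hn hJn
    have hn' : (0 : ℝ) < n := by exact_mod_cast hn
    have hsh : Tendsto (fun z : ℝ => z + 1 / n) atTop atTop := tendsto_atTop_add_const_right _ _ tendsto_id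
    filter_upwards [hsh.eventually (hev n hn), eventually_gt_atTop 0] with z hz hz0
    have h1 := le_integral_mul_fejer (g := fun v => f (z + 1 / n - v / (n : ℝ) ^ 2)) (M := M)
      (c := a z * Real.exp (-2 / n) - 1) (V := n) (by fun_prop) (fun v => hfM _) ?_
    · have h2 := h1.trans ((le_abs_self _).trans hz)
      have h3 : (a z * Real.exp (-2 / n) - 1) * J n ≤ M * (I - J n) + 1 / n := by linarith
      rw [← le_div_iff₀ hJn] at h3
      have h4 : a z * Real.exp (-2 / n) ≤ 1 + e n := by linarith
      have h5 : Real.exp (2 / n) * Real.exp (-2 / n) = 1 := by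
        rw [← Real.exp_add, ← Real.exp_zero]; congr 1; ring
      calc a z = Real.exp (2 / n) * (a z * Real.exp (-2 / n)) := by linear_combination -a z * h5
        _ ≤ _ := by gcongr
    · intro v hv
      obtain ⟨e1, e2, e3⟩ := hloc n hn (z + 1 / n) v (by linarith) hv
      rw [e1]
      set y := z + 1 / n - v / (n : ℝ) ^ 2
      have h6 := hcmp z y (by linarith)
      have h7 : Real.exp (y - z) ≤ Real.exp (2 / n) := by
        apply Real.exp_le_exp.2
        have : (2 : ℝ) / n = 1 / n + 1 / n := by ring
        linarith
      have h8 : a z ≤ a y * Real.exp (2 / n) := h6.trans (by gcongr; exact ha0 y)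
      have h5 : Real.exp (2 / n) * Real.exp (-2 / n) = 1 := by
        rw [← Real.exp_add, ← Real.exp_zero]; congr 1; ring
      have : a z * Real.exp (-2 / n) ≤ a y := by
        calc _ ≤ a y * Real.exp (2 / n) * Real.exp (-2 / n) := by gcongr
          _ = a y := by rw [mul_assoc, h5, mul_one]
      linarith
  have key_low : ∀ n : ℕ, 0 < n → 0 < J n → ∀ᶠ z : ℝ in atTop,
      Real.exp (-2 / n) * (1 - e n) ≤ a z := by
    intro n hn hJn
    have hn' : (0 : ℝ) < n := by exact_mod_cast hn
    have hsh : Tendsto (fun z : ℝ => z - 1 / n) atTop atTop := tendsto_atTop_add_const_right _ _ tendsto_id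
    filter_upwards [hsh.eventually (hev n hn), eventually_gt_atTop (2 / (n : ℝ))] with z hz hz0
    have hnn : (2 : ℝ) / n = 1 / n + 1 / n := by ring
    have h1 := le_integral_mul_fejer (g := fun v => -f (z - 1 / n - v / (n : ℝ) ^ 2)) (M := M)
      (c := -(a z * Real.exp (2 / n) - 1)) (V := n) (by fun_prop)
      (fun v => by rw [abs_neg]; exact hfM _) ?_
    · simp_rw [neg_mul] at h1
      rw [integral_neg] at h1
      have h2 := h1.trans ((neg_le_abs _).trans hz)
      have h3 : (1 - a z * Real.exp (2 / n)) * J n ≤ M * (I - J n) + 1 / n := by linarith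
      rw [← le_div_iff₀ hJn] at h3
      have h4 : 1 - e n ≤ a z * Real.exp (2 / n) := by linarith
      have h5 : Real.exp (2 / n) * Real.exp (-2 / n) = 1 := by
        rw [← Real.exp_add, ← Real.exp_zero]; congr 1; ring
      calc _ ≤ Real.exp (-2 / n) * (a z * Real.exp (2 / n)) := by gcongr
        _ = a z := by linear_combination a z * h5
    · intro v hv
      obtain ⟨e1, e2, e3⟩ := hloc n hn (z - 1 / n) v (by linarith) hv
      rw [e1]
      set y := z - 1 / n - v / (n : ℝ) ^ 2
      have h6 := hcmp y z (by linarith)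
      have h7 : Real.exp (z - y) ≤ Real.exp (2 / n) := by
        apply Real.exp_le_exp.2
        linarith
      have h8 : a y ≤ a z * Real.exp (2 / n) := h6.trans (by gcongr; exact ha0 z)
      linarith
  rw [tendsto_order]
  constructor
  · intro b hb
    obtain ⟨n, h1, h2, h3⟩ := ((hlow.eventually (lt_mem_nhds hb)).and
      ((eventually_gt_atTop 0).and hJpos)).exists
    filter_upwards [key_low n h2 h3] with z hz using h1.trans_le hz
  · intro b hb
    obtain ⟨n, h1, h2, h3⟩ := ((hup.eventually (gt_mem_nhds hb)).and
      ((eventually_gt_atTop 0).and hJpos)).exists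
    filter_upwards [key_up n h2 h3] with z hz using hz.trans_lt h1

theorem LSeries_one_add_eq_mul_integral {f : ℕ → ℝ}
    (hO : (fun n ↦ ∑ k ∈ Finset.Icc 1 n, f k) =O[atTop] fun n ↦ (n : ℝ))
    (hf : ∀ n, 0 ≤ f n) {z : ℂ} (hz : 0 < z.re) :
    LSeries (fun n ↦ f n) (1 + z) = (1 + z) * ∫ u : ℝ in Ioi 0,
      (((∑ k ∈ Finset.Icc 1 ⌊Real.exp u⌋₊, f k) * Real.exp (-u) : ℝ) : ℂ) *
        Complex.exp (-z * u) := by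
  rw [LSeries_eq_mul_integral_of_nonneg f zero_le_one (by simpa) (by simpa using hO) hf]
  congr 1
  rw [← Real.exp_zero, ← integral_comp_exp_Ioi]
  refine setIntegral_congr_fun measurableSet_Ioi fun u _ ↦ ?_
  have h : ((Real.exp u : ℝ) : ℂ) ^ (-(1 + z + 1)) =
      Complex.exp (-u) * (Complex.exp (-u) * Complex.exp (-z * u)) := by
    rw [Complex.cpow_def_of_ne_zero (by simp),
      ← Complex.ofReal_log (Real.exp_pos u).le, Real.log_exp, ← Complex.exp_add, ← Complex.exp_add]
    congr 1
    ring
  have h2 : Complex.exp u * Complex.exp (-u) = 1 := by rw [← Complex.exp_add]; simp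
  simp only [Complex.real_smul]
  rw [h]
  push_cast
  linear_combination ((∑ k ∈ Finset.Icc 1 ⌊Real.exp u⌋₊, (f k : ℂ)) * Complex.exp (-u) *
    Complex.exp (-z * u)) * h2

theorem integrableOn_mul_cexp_neg_mul {a : ℝ → ℝ} {M : ℝ} (ha : Measurable a)
    (hM : ∀ u, |a u| ≤ M) {z : ℂ} (hz : 0 < z.re) :
    IntegrableOn (fun u : ℝ ↦ (a u : ℂ) * Complex.exp (-z * u)) (Ioi 0) := by
  refine Integrable.bdd_mul (c := M)
    (integrableOn_exp_mul_complex_Ioi (a := -z) (by simpa using hz) 0)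
    (Complex.measurable_ofReal.comp ha).aestronglyMeasurable (ae_of_all _ fun u ↦ ?_)
  simpa using hM u

theorem psi_eq_sum_Icc (x : ℝ) :
    Chebyshev.psi x = ∑ k ∈ Finset.Icc 1 ⌊x⌋₊, ArithmeticFunction.vonMangoldt k := rfl

theorem isBigO_sum_vonMangoldt :
    (fun n ↦ ∑ k ∈ Finset.Icc 1 n, ArithmeticFunction.vonMangoldt k) =O[atTop]
      fun n ↦ (n : ℝ) := by
  refine Asymptotics.IsBigO.of_bound (Real.log 4 + 4) (Eventually.of_forall fun n ↦ ?_)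
  have h := Chebyshev.psi_le_const_mul_self (x := n) (by positivity)
  rw [psi_eq_sum_Icc, Nat.floor_natCast] at h
  rw [Real.norm_of_nonneg (Finset.sum_nonneg fun _ _ ↦ ArithmeticFunction.vonMangoldt_nonneg),
    Real.norm_of_nonneg (by positivity)]
  exact h

theorem abs_psi_exp_mul_exp_neg_le (u : ℝ) :
    |Chebyshev.psi (Real.exp u) * Real.exp (-u)| ≤ Real.log 4 + 4 := by
  rw [abs_of_nonneg (mul_nonneg (Chebyshev.psi_nonneg _) (Real.exp_pos _).le), Real.exp_neg,
    ← div_eq_mul_inv, div_le_iff₀ (Real.exp_pos u)]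
  exact Chebyshev.psi_le_const_mul_self (Real.exp_pos u).le

theorem measurable_psi_exp_mul_exp_neg :
    Measurable fun u ↦ Chebyshev.psi (Real.exp u) * Real.exp (-u) :=
  (Chebyshev.psi_mono.comp Real.exp_monotone).measurable.mul (by fun_prop)

open ArithmeticFunction.vonMangoldt in
theorem integral_psi_sub_one_mul_cexp {z : ℂ} (hz : 0 < z.re) :
    ∫ u : ℝ in Ioi 0, ((Chebyshev.psi (Real.exp u) * Real.exp (-u) - 1 : ℝ) : ℂ) *
      Complex.exp (-z * u) = (LFunctionResidueClassAux (1 : ZMod 1) (1 + z) - 1) / (1 + z) := by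
  have hz0 : z ≠ 0 := by rintro rfl; simp at hz
  have hz1 : 1 + z ≠ 0 := by
    intro h
    have := congrArg Complex.re h
    simp at this
    linarith
  have h1 := LSeries_one_add_eq_mul_integral isBigO_sum_vonMangoldt
    (fun _ ↦ ArithmeticFunction.vonMangoldt_nonneg) hz
  have h2 := eqOn_LFunctionResidueClassAux (q := 1) (a := 1) isUnit_one
    (show 1 + z ∈ {s : ℂ | 1 < s.re} by simpa using hz)
  have h3 : (residueClass (1 : ZMod 1)) = fun n ↦ ArithmeticFunction.vonMangoldt n := by
    ext n
    simp [residueClass, Subsingleton.elim (n : ZMod 1) 1]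
  simp only [h3, h1, Nat.totient_one, Nat.cast_one, inv_one, add_sub_cancel_left] at h2
  have h4 : ∫ u : ℝ in Ioi 0, Complex.exp (-z * u) = 1 / z := by
    rw [integral_exp_mul_complex_Ioi (by simpa using hz)]
    simp
  simp only [Complex.ofReal_sub, sub_mul, Complex.ofReal_one, one_mul]
  rw [integral_sub (integrableOn_mul_cexp_neg_mul measurable_psi_exp_mul_exp_neg
    abs_psi_exp_mul_exp_neg_le hz) (integrableOn_exp_mul_complex_Ioi (by simpa using hz) 0),
    h2, h4]
  simp only [psi_eq_sum_Icc]
  field_simp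
  ring

open ArithmeticFunction.vonMangoldt in
theorem tendsto_psi_exp_mul_exp_neg :
    Tendsto (fun u ↦ Chebyshev.psi (Real.exp u) * Real.exp (-u)) atTop (𝓝 1) := by
  refine tendsto_one_of_laplace_continuousOn (M := Real.log 4 + 4 + 1) ?_ (fun u ↦ ?_)
    (G := fun z ↦ (LFunctionResidueClassAux (1 : ZMod 1) (1 + z) - 1) / (1 + z)) ?_
    fun z hz ↦ integral_psi_sub_one_mul_cexp hz
  · intro u v huv
    simp only [mul_assoc, ← Real.exp_add, neg_add_cancel, Real.exp_zero, mul_one]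
    exact Chebyshev.psi_mono (Real.exp_monotone huv)
  · refine (abs_sub _ _).trans ?_
    simpa using abs_psi_exp_mul_exp_neg_le u
  · have h : ContinuousOn (fun z : ℂ ↦ LFunctionResidueClassAux (1 : ZMod 1) (1 + z))
        {z | 0 ≤ z.re} :=
      (continuousOn_LFunctionResidueClassAux (1 : ZMod 1)).comp (by fun_prop)
        fun z hz ↦ by simpa using hz
    refine (h.sub continuousOn_const).div (by fun_prop) fun z hz h0 ↦ ?_
    have := congrArg Complex.re h0
    simp at this hz
    linarith

/-- The prime number theorem for the Chebyshev function `ψ`. -/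
theorem tendsto_psi_div_id : Tendsto (fun x ↦ Chebyshev.psi x / x) atTop (𝓝 1) := by
  refine (tendsto_psi_exp_mul_exp_neg.comp Real.tendsto_log_atTop).congr' ?_
  filter_upwards [eventually_gt_atTop 0] with x hx
  simp [Real.exp_log hx, Real.exp_neg, div_eq_mul_inv]

/-- The prime number theorem for the Chebyshev function `θ`. -/
theorem tendsto_theta_div_id : Tendsto (fun x ↦ Chebyshev.theta x / x) atTop (𝓝 1) := by
  have h1 : (Chebyshev.psi - Chebyshev.theta) =o[atTop] fun x : ℝ ↦ x := by
    refine Chebyshev.isBigO_psi_sub_theta_sqrt.trans_isLittleO ?_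
    refine Asymptotics.isLittleO_of_tendsto (fun x hx ↦ by simp [hx]) ?_
    refine (tendsto_inv_atTop_zero.comp Real.tendsto_sqrt_atTop).congr fun x ↦ ?_
    simp [Real.sqrt_div_self]
  have h2 := tendsto_psi_div_id.sub h1.tendsto_div_nhds_zero
  rw [sub_zero] at h2
  refine h2.congr fun x ↦ ?_
  simp [← sub_div]

/-- The prime number theorem. -/
theorem tendsto_primeCounting_mul_log_div_id :
    Tendsto (fun x : ℝ ↦ (⌊x⌋₊.primeCounting : ℝ) * Real.log x / x) atTop (𝓝 1) := by
  have h1 := tendsto_theta_div_id.add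
    Chebyshev.integral_theta_div_log_sq_isLittleO.tendsto_div_nhds_zero
  rw [add_zero] at h1
  refine h1.congr' ?_
  filter_upwards [eventually_ge_atTop 2] with x hx
  have hlog : Real.log x ≠ 0 := (Real.log_pos (by linarith)).ne'
  rw [Chebyshev.primeCounting_eq_theta_div_log_add_integral hx]
  field_simp

theorem integrableOn_exp_neg_mul_log : IntegrableOn (fun s : ℝ ↦ Real.exp (-s) * Real.log s)
    (Ioi 0) := by
  rw [← Ioc_union_Ioi_eq_Ioi zero_le_one]
  refine IntegrableOn.union ?_ ?_
  · have h : IntegrableOn Real.log (Ioc 0 1) :=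
      (intervalIntegrable_iff_integrableOn_Ioc_of_le zero_le_one).1
        intervalIntegral.intervalIntegrable_log'
    refine Integrable.bdd_mul (c := 1) h (by fun_prop) ?_
    refine (ae_restrict_iff' measurableSet_Ioc).2 (ae_of_all _ fun s hs ↦ ?_)
    simpa using hs.1.le
  · have h : IntegrableOn (fun s : ℝ ↦ Real.exp (-s) * s ^ ((2 : ℝ) - 1)) (Ioi 1) :=
      (Real.GammaIntegral_convergent (by norm_num)).mono_set (Ioi_subset_Ioi zero_le_one)
    refine h.mono' (by fun_prop) ?_
    refine (ae_restrict_iff' measurableSet_Ioi).2 (ae_of_all _ fun s (hs : 1 < s) ↦ ?_)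
    rw [norm_mul, Real.norm_of_nonneg (Real.exp_pos _).le,
      Real.norm_of_nonneg (Real.log_nonneg hs.le)]
    gcongr
    norm_num
    linarith [Real.log_le_sub_one_of_pos (show 0 < s by linarith)]

theorem integral_exp_neg_mul_log :
    ∫ s : ℝ in Ioi 0, Real.exp (-s) * Real.log s = -Real.eulerMascheroniConstant := by
  have h1 := Complex.hasDerivAt_GammaIntegral (s := 1) (by simp)
  have h2 : Complex.GammaIntegral =ᶠ[𝓝 1] Complex.Gamma := by
    have : IsOpen {s : ℂ | 0 < s.re} := Complex.continuous_re.isOpen_preimage _ isOpen_Ioi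
    filter_upwards [this.mem_nhds (show (0 : ℝ) < (1 : ℂ).re by simp)] with a ha
    exact (Complex.Gamma_eq_integral ha).symm
  have h3 := (h1.congr_of_eventuallyEq h2.symm).unique Complex.hasDerivAt_Gamma_one
  have h4 : ∫ t : ℝ in Ioi 0, (t : ℂ) ^ ((1 : ℂ) - 1) * (Real.log t * Real.exp (-t)) =
      ∫ t : ℝ in Ioi 0, ((Real.exp (-t) * Real.log t : ℝ) : ℂ) := by
    refine integral_congr_ae (ae_of_all _ fun t ↦ ?_)
    simp [mul_comm]
  rw [h4, integral_complex_ofReal] at h3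
  exact_mod_cast h3

theorem integrableOn_exp_neg_sub_one_div :
    IntegrableOn (fun s : ℝ ↦ (Real.exp (-s) - 1) / s) (Ioc 0 1) := by
  refine Measure.integrableOn_of_bounded (M := 1) (by simp)
    (Measurable.aestronglyMeasurable (by fun_prop)) ?_
  refine (ae_restrict_iff' measurableSet_Ioc).2 (ae_of_all _ fun s hs ↦ ?_)
  rw [norm_div, Real.norm_of_nonneg hs.1.le, div_le_one hs.1, Real.norm_eq_abs, abs_le]
  have h1 := Real.add_one_le_exp (-s)
  have h2 : Real.exp (-s) ≤ 1 := by simpa using hs.1.le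
  constructor <;> linarith [hs.1]

theorem integrableOn_exp_neg_div : IntegrableOn (fun s : ℝ ↦ Real.exp (-s) / s) (Ioi 1) := by
  refine (integrableOn_exp_neg_Ioi 1).mono' (Measurable.aestronglyMeasurable (by fun_prop)) ?_
  refine (ae_restrict_iff' measurableSet_Ioi).2 (ae_of_all _ fun s (hs : 1 < s) ↦ ?_)
  rw [norm_div, Real.norm_of_nonneg (zero_le_one.trans hs.le),
    Real.norm_of_nonneg (Real.exp_pos _).le]
  exact div_le_self (Real.exp_pos _).le hs.le

theorem integral_exp_neg_sub_one_div :
    ∫ s : ℝ in Ioc 0 1, (Real.exp (-s) - 1) / s =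
      ∫ s : ℝ in Ioc 0 1, Real.exp (-s) * Real.log s := by
  have hlog := integrableOn_exp_neg_mul_log.mono_set (show Ioc (0 : ℝ) 1 ⊆ Ioi 0 from Ioc_subset_Ioi_self)
  have hF : IntervalIntegrable
      (fun s : ℝ ↦ (Real.exp (-s) - 1) / s - Real.exp (-s) * Real.log s) volume 0 1 :=
    (intervalIntegrable_iff_integrableOn_Ioc_of_le zero_le_one).2
      (integrableOn_exp_neg_sub_one_div.sub hlog)
  have hlim : Tendsto (fun s : ℝ ↦ (Real.exp (-s) - 1) * Real.log s) (𝓝[>] 0) (𝓝 0) := by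
    have h : Tendsto (fun s : ℝ ↦ |s * Real.log s|) (𝓝[>] 0) (𝓝 0) := by
      simpa using (Real.continuous_mul_log.abs.tendsto 0).mono_left nhdsWithin_le_nhds
    refine squeeze_zero_norm' ?_ h
    filter_upwards [self_mem_nhdsWithin] with s (hs : 0 < s)
    rw [norm_mul, abs_mul, Real.norm_eq_abs, Real.norm_eq_abs]
    refine mul_le_mul_of_nonneg_right ?_ (abs_nonneg _)
    rw [abs_of_pos hs, abs_le]
    have h1 := Real.add_one_le_exp (-s)
    have h2 : Real.exp (-s) ≤ 1 := by simpa using hs.le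
    constructor <;> linarith
  have hlim1 : Tendsto (fun s : ℝ ↦ (Real.exp (-s) - 1) * Real.log s) (𝓝[<] 1) (𝓝 0) := by
    have h : ContinuousAt (fun s : ℝ ↦ (Real.exp (-s) - 1) * Real.log s) 1 := by
      fun_prop (disch := norm_num)
    simpa using h.tendsto.mono_left nhdsWithin_le_nhds
  have h := intervalIntegral.integral_eq_sub_of_hasDerivAt_of_tendsto zero_lt_one
    (fun s hs ↦ ?_) hF hlim hlim1
  · rw [intervalIntegral.integral_of_le zero_le_one,
      integral_sub integrableOn_exp_neg_sub_one_div hlog] at h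
    linarith
  · have := (((hasDerivAt_neg s).exp.sub_const 1)).mul (Real.hasDerivAt_log hs.1.ne')
    convert! this using 1
    ring

theorem integral_exp_neg_div :
    ∫ s : ℝ in Ioi 1, Real.exp (-s) / s = ∫ s : ℝ in Ioi 1, Real.exp (-s) * Real.log s := by
  have hlog := integrableOn_exp_neg_mul_log.mono_set (Ioi_subset_Ioi (zero_le_one' ℝ))
  have hlim : Tendsto (fun s : ℝ ↦ Real.exp (-s) * Real.log s) atTop (𝓝 0) := by
    have h : Tendsto (fun s : ℝ ↦ s * Real.exp (-s)) atTop (𝓝 0) := by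
      simpa using Real.tendsto_pow_mul_exp_neg_atTop_nhds_zero 1
    refine squeeze_zero' ?_ ?_ h
    · filter_upwards [eventually_ge_atTop 1] with s hs
      exact mul_nonneg (Real.exp_pos _).le (Real.log_nonneg hs)
    · filter_upwards [eventually_ge_atTop 1] with s hs
      rw [mul_comm]
      gcongr
      linarith [Real.log_le_sub_one_of_pos (show 0 < s by linarith)]
  have h := integral_Ioi_of_hasDerivAt_of_tendsto' (a := (1 : ℝ))
    (f' := fun s ↦ Real.exp (-s) / s - Real.exp (-s) * Real.log s) (fun s (hs : 1 ≤ s) ↦ ?_)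
    (integrableOn_exp_neg_div.sub hlog) hlim
  · rw [integral_sub integrableOn_exp_neg_div hlog, Real.log_one] at h
    linarith
  · have := (hasDerivAt_neg s).exp.mul (Real.hasDerivAt_log (show s ≠ 0 by linarith))
    convert! this using 1
    ring

theorem integrableOn_exp_neg_sub_indicator_div :
    IntegrableOn (fun s : ℝ ↦ (Real.exp (-s) - (Iic 1).indicator 1 s) / s) (Ioi 0) := by
  rw [← Ioc_union_Ioi_eq_Ioi zero_le_one]
  refine IntegrableOn.union ?_ ?_
  · refine integrableOn_exp_neg_sub_one_div.congr_fun (fun s hs ↦ ?_) measurableSet_Ioc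
    simp [indicator_of_mem (show s ∈ Iic 1 from hs.2)]
  · refine integrableOn_exp_neg_div.congr_fun (fun s hs ↦ ?_) measurableSet_Ioi
    simp [indicator_of_notMem (show s ∉ Iic 1 from not_le.2 (mem_Ioi.1 hs))]

theorem integral_exp_neg_sub_indicator_div :
    ∫ s : ℝ in Ioi 0, (Real.exp (-s) - (Iic 1).indicator 1 s) / s =
      -Real.eulerMascheroniConstant := by
  have h := integrableOn_exp_neg_sub_indicator_div
  have hlog := integrableOn_exp_neg_mul_log
  rw [← integral_exp_neg_mul_log]
  rw [← Ioc_union_Ioi_eq_Ioi zero_le_one] at h hlog ⊢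
  rw [setIntegral_union Ioc_disjoint_Ioi_same measurableSet_Ioi h.left_of_union h.right_of_union,
    setIntegral_union Ioc_disjoint_Ioi_same measurableSet_Ioi hlog.left_of_union
      hlog.right_of_union, ← integral_exp_neg_sub_one_div, ← integral_exp_neg_div]
  congr 1
  · refine setIntegral_congr_fun measurableSet_Ioc fun s hs ↦ ?_
    simp [indicator_of_mem (show s ∈ Iic 1 from hs.2)]
  · refine setIntegral_congr_fun measurableSet_Ioi fun s hs ↦ ?_
    simp [indicator_of_notMem (show s ∉ Iic 1 from not_le.2 (mem_Ioi.1 hs))]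

theorem tendsto_integral_mul_exp_neg_div_sub {q : ℝ → ℝ} {C : ℝ} (hq : Measurable q)
    (hq0 : ∀ w, |q w| ≤ 1) (hC : ∀ w, |w * q w| ≤ C)
    (hlim : Tendsto (fun w ↦ w * q w) atTop (𝓝 1)) :
    Tendsto (fun u ↦ (∫ w in Ioi 0, q w * Real.exp (-(w / u))) - ∫ w in Ioc 0 u, q w) atTop
      (𝓝 (-Real.eulerMascheroniConstant)) := by
  have key : Tendsto (fun u : ℝ ↦ ∫ s : ℝ in Ioi 0, (u * s * q (u * s)) *
      ((Real.exp (-s) - (Iic 1).indicator 1 s) / s)) atTop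
      (𝓝 (∫ s : ℝ in Ioi 0, 1 * ((Real.exp (-s) - (Iic 1).indicator 1 s) / s))) := by
    refine tendsto_integral_filter_of_dominated_convergence
      (fun s ↦ C * ‖(Real.exp (-s) - (Iic 1).indicator 1 s) / s‖) ?_ ?_ ?_ ?_
    · refine Eventually.of_forall fun u ↦ Measurable.aestronglyMeasurable ?_
      have : Measurable ((Iic 1).indicator (1 : ℝ → ℝ)) := measurable_one.indicator measurableSet_Iic
      fun_prop
    · refine Eventually.of_forall fun u ↦ ae_of_all _ fun s ↦ ?_
      rw [norm_mul]
      gcongr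
      exact hC _
    · exact integrableOn_exp_neg_sub_indicator_div.norm.const_mul C
    · refine (ae_restrict_iff' measurableSet_Ioi).2 (ae_of_all _ fun s (hs : 0 < s) ↦ ?_)
      refine Tendsto.mul_const _ (hlim.comp ?_)
      exact tendsto_id.atTop_mul_const hs
  simp only [one_mul, integral_exp_neg_sub_indicator_div] at key
  refine key.congr' ?_
  filter_upwards [eventually_gt_atTop 0] with u hu
  have h1 : IntegrableOn (fun w ↦ q w * Real.exp (-(w / u))) (Ioi 0) := by
    have : IntegrableOn (fun w ↦ Real.exp (-(1 / u) * w)) (Ioi 0) :=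
      integrableOn_exp_mul_Ioi (by simpa using hu) 0
    refine (this.bdd_mul (c := 1) hq.aestronglyMeasurable (ae_of_all _ hq0)).congr
      (ae_of_all _ fun w ↦ ?_)
    simp only
    congr 2
    ring
  have h2 : IntegrableOn ((Iic u).indicator q) (Ioi 0) := by
    rw [integrableOn_indicator_iff measurableSet_Iic, inter_comm, Ioi_inter_Iic]
    exact Measure.integrableOn_of_bounded (M := 1) (by simp) hq.aestronglyMeasurable
      (ae_of_all _ hq0)
  have h3 : ∫ w in Ioc 0 u, q w = ∫ w in Ioi 0, (Iic u).indicator q w := by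
    rw [setIntegral_indicator measurableSet_Iic, Ioi_inter_Iic]
  rw [h3, ← integral_sub h1 h2]
  have h4 := integral_comp_mul_left_Ioi
    (fun w ↦ q w * Real.exp (-(w / u)) - (Iic u).indicator q w) 0 hu
  rw [mul_zero, smul_eq_mul, eq_inv_mul_iff_mul_eq₀ hu.ne', ← integral_const_mul] at h4
  rw [← h4]
  refine setIntegral_congr_fun measurableSet_Ioi fun s (hs : 0 < s) ↦ ?_
  have h5 : (Iic u).indicator q (u * s) = (Iic 1).indicator 1 s * q (u * s) := by
    by_cases h : s ≤ 1
    · rw [indicator_of_mem (show s ∈ Iic 1 from h), indicator_of_mem]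
      · simp
      · exact mul_le_of_le_one_right hu.le h
    · rw [indicator_of_notMem (show s ∉ Iic 1 from h), indicator_of_notMem]
      · simp
      · simpa [hu] using h
  simp only [h5]
  field_simp

/-- The proportion of primes up to `exp w`. -/
noncomputable def primeDensity (w : ℝ) : ℝ := (⌊Real.exp w⌋₊.primeCounting : ℝ) * Real.exp (-w)

theorem measurable_primeDensity : Measurable primeDensity := by
  have : Monotone fun w ↦ (⌊Real.exp w⌋₊.primeCounting : ℝ) := fun v w h ↦
    Nat.cast_le.2 (Nat.monotone_primeCounting (Nat.floor_mono (Real.exp_monotone h)))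
  exact this.measurable.mul (by fun_prop)

theorem primeDensity_nonneg (w : ℝ) : 0 ≤ primeDensity w :=
  mul_nonneg (Nat.cast_nonneg _) (Real.exp_pos _).le

theorem primeCounting_le_self (n : ℕ) : n.primeCounting ≤ n := by
  rw [← Nat.primesLE_card_eq_primeCounting, Nat.primesLE_eq_filter_Icc_one]
  simpa using Finset.card_filter_le (Finset.Icc 1 n) Nat.Prime

theorem primeDensity_le_one (w : ℝ) : primeDensity w ≤ 1 := by
  rw [primeDensity, Real.exp_neg, ← div_eq_mul_inv, div_le_one (Real.exp_pos w)]
  refine le_trans ?_ (Nat.floor_le (Real.exp_pos w).le)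
  exact_mod_cast primeCounting_le_self _

theorem abs_primeDensity_le_one (w : ℝ) : |primeDensity w| ≤ 1 := by
  rw [abs_of_nonneg (primeDensity_nonneg w)]
  exact primeDensity_le_one w

theorem primeDensity_of_nonpos {w : ℝ} (hw : w ≤ 0) : primeDensity w = 0 := by
  have : ⌊Real.exp w⌋₊ ≤ 1 := Nat.floor_le_of_le (by simpa using hw)
  rw [primeDensity, Nat.primeCounting_eq_zero_iff.2 this]
  simp

theorem tendsto_mul_primeDensity : Tendsto (fun w ↦ w * primeDensity w) atTop (𝓝 1) := by
  refine (tendsto_primeCounting_mul_log_div_id.comp Real.tendsto_exp_atTop).congr fun w ↦ ?_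
  simp only [Function.comp, Real.log_exp, primeDensity, Real.exp_neg]
  ring

theorem exists_abs_mul_primeDensity_le : ∃ C, ∀ w, |w * primeDensity w| ≤ C := by
  obtain ⟨W, hW⟩ := eventually_atTop.1
    (tendsto_mul_primeDensity.eventually (gt_mem_nhds one_lt_two))
  refine ⟨max W 2, fun w ↦ ?_⟩
  rcases le_or_gt w 0 with hw | hw
  · simp [primeDensity_of_nonpos hw]
  rw [abs_of_nonneg (mul_nonneg hw.le (primeDensity_nonneg w))]
  rcases le_total W w with h | h
  · exact (hW w h).le.trans (le_max_right _ _)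
  · refine le_trans ?_ (le_max_left _ _)
    exact (mul_le_of_le_one_right hw.le (primeDensity_le_one w)).trans h

theorem sum_ite_prime_eq_primeCounting (n : ℕ) :
    ∑ k ∈ Finset.Icc 1 n, (if k.Prime then (1 : ℝ) else 0) = n.primeCounting := by
  rw [← Nat.primesLE_card_eq_primeCounting, Nat.primesLE_eq_filter_Icc_one, Finset.sum_ite]
  simp

theorem sum_primesLE_one_div (u : ℝ) :
    ∑ p ∈ Nat.primesLE ⌊Real.exp u⌋₊, 1 / (p : ℝ) =
      primeDensity u + ∫ w in Ioc 0 u, primeDensity w := by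
  have hne : ∀ t ∈ Icc 1 (Real.exp u), t ≠ 0 := fun t ht ↦ (zero_lt_one.trans_le ht.1).ne'
  have hderiv : ∀ t, deriv (fun t : ℝ ↦ 1 / t) t = -(t ^ 2)⁻¹ := fun t ↦ by simp
  have h := sum_mul_eq_sub_integral_mul₀ (𝕜 := ℝ) (fun k ↦ if k.Prime then (1 : ℝ) else 0)
    (f := fun t ↦ 1 / t) (by simp [Nat.not_prime_zero]) (Real.exp u)
    (fun t ht ↦ by have := hne t ht; fun_prop (disch := assumption)) (by
      rw [funext hderiv]
      refine ContinuousOn.integrableOn_Icc ?_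
      refine (ContinuousOn.inv₀ (by fun_prop) fun t ht ↦ ?_).neg
      exact pow_ne_zero 2 (hne t ht))
  have hsum : ∀ n : ℕ, ∑ k ∈ Finset.Icc 0 n, (if k.Prime then (1 : ℝ) else 0) =
      n.primeCounting := fun n ↦ by
    rw [← Nat.primesLE_card_eq_primeCounting, Nat.primesLE_eq_filter_Icc_zero, Finset.sum_ite]
    simp
  rw [Nat.primesLE_eq_filter_Icc_zero, Finset.sum_filter]
  simp only [mul_ite, mul_one, mul_zero] at h
  rw [h]
  simp only [hsum, hderiv]
  have h2 := integral_comp_exp_Ioi ((Iic (Real.exp u)).indicator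
    fun t ↦ (⌊t⌋₊.primeCounting : ℝ) / t ^ 2) 0
  rw [Real.exp_zero, setIntegral_indicator measurableSet_Iic, Ioi_inter_Iic] at h2
  have h3 : ∫ w in Ioc 0 u, primeDensity w = ∫ w in Ioi 0, (Iic u).indicator primeDensity w := by
    rw [setIntegral_indicator measurableSet_Iic, Ioi_inter_Iic]
  have h4 : ∫ w in Ioi 0, (Iic u).indicator primeDensity w =
      ∫ t in Ioc 1 (Real.exp u), (⌊t⌋₊.primeCounting : ℝ) / t ^ 2 := by
    rw [← h2]
    refine setIntegral_congr_fun measurableSet_Ioi fun w _ ↦ ?_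
    have he := (Real.exp_pos w).ne'
    by_cases hw : w ≤ u
    · rw [indicator_of_mem (show w ∈ Iic u from hw),
        indicator_of_mem (show Real.exp w ∈ Iic (Real.exp u) from Real.exp_le_exp.2 hw),
        primeDensity, smul_eq_mul, Real.exp_neg]
      field_simp
    · rw [indicator_of_notMem (show w ∉ Iic u from hw),
        indicator_of_notMem (show Real.exp w ∉ Iic (Real.exp u) from
          fun h ↦ hw (Real.exp_le_exp.1 h)), smul_zero]
  rw [h3, h4, sub_eq_add_neg, ← integral_neg]
  congr 1
  · rw [primeDensity, Real.exp_neg]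
    ring
  · refine setIntegral_congr_fun measurableSet_Ioc fun t _ ↦ ?_
    ring

theorem tsum_primes_rpow_neg {δ : ℝ} (hδ : 0 < δ) :
    ∑' p : Nat.Primes, (p : ℝ) ^ (-(1 + δ)) =
      (1 + δ) * ∫ w in Ioi 0, primeDensity w * Real.exp (-δ * w) := by
  have hO : (fun n : ℕ ↦ ∑ k ∈ Finset.Icc 1 n, (if k.Prime then (1 : ℝ) else 0)) =O[atTop]
      fun n ↦ (n : ℝ) := by
    refine Asymptotics.IsBigO.of_bound 1 (Eventually.of_forall fun n ↦ ?_)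
    rw [sum_ite_prime_eq_primeCounting, one_mul, Real.norm_of_nonneg (Nat.cast_nonneg _),
      Real.norm_of_nonneg (Nat.cast_nonneg _)]
    exact_mod_cast primeCounting_le_self n
  have h := LSeries_one_add_eq_mul_integral hO (fun n ↦ by split_ifs <;> simp)
    (z := δ) (by simpa using hδ)
  have h1 : LSeries (fun n ↦ ((if n.Prime then (1 : ℝ) else 0 : ℝ) : ℂ)) (1 + δ) =
      ((∑' p : Nat.Primes, (p : ℝ) ^ (-(1 + δ)) : ℝ) : ℂ) := by
    rw [Complex.ofReal_tsum, LSeries]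
    rw [← tsum_subtype_eq_of_support_subset (s := {p : ℕ | p.Prime})]
    · refine tsum_congr fun p ↦ ?_
      have hp : p.1.Prime := p.2
      rw [LSeries.term_of_ne_zero hp.ne_zero, if_pos hp, Complex.ofReal_cpow (Nat.cast_nonneg _),
        Complex.ofReal_neg, Complex.cpow_neg]
      simp
    · intro n hn
      by_contra hp
      change ¬ n.Prime at hp
      simp [LSeries.term, hp] at hn
  have h2 : ∫ u : ℝ in Ioi 0, (((∑ k ∈ Finset.Icc 1 ⌊Real.exp u⌋₊,
      (if k.Prime then (1 : ℝ) else 0)) * Real.exp (-u) : ℝ) : ℂ) * Complex.exp (-δ * u) =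
      ((∫ w in Ioi 0, primeDensity w * Real.exp (-δ * w) : ℝ) : ℂ) := by
    rw [← integral_complex_ofReal]
    refine integral_congr_ae (ae_of_all _ fun u ↦ ?_)
    simp only [sum_ite_prime_eq_primeCounting, primeDensity]
    push_cast
    rfl
  rw [h1, h2] at h
  exact_mod_cast h

theorem neg_log_one_sub_sub_nonneg {x : ℝ} (hx : x < 1) : 0 ≤ -Real.log (1 - x) - x := by
  linarith [Real.log_le_sub_one_of_pos (show 0 < 1 - x by linarith)]

theorem neg_log_one_sub_sub_le {x : ℝ} (hx : x ≤ 1 / 2) :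
    -Real.log (1 - x) - x ≤ 2 * x ^ 2 := by
  have h := Real.one_sub_inv_le_log_of_pos (show 0 < 1 - x by linarith)
  have h1 : (1 - x)⁻¹ ≤ 1 + x + 2 * x ^ 2 := by
    rw [inv_le_iff_one_le_mul₀ (by linarith)]
    nlinarith [sq_nonneg x]
  linarith

theorem prime_rpow_neg_le {s : ℝ} (hs : 1 ≤ s) (p : Nat.Primes) :
    (p : ℝ) ^ (-s) ≤ (p : ℝ) ^ (-1 : ℝ) :=
  Real.rpow_le_rpow_of_exponent_le (by exact_mod_cast p.2.one_le) (by linarith)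

theorem prime_rpow_neg_one_le (p : Nat.Primes) : (p : ℝ) ^ (-1 : ℝ) ≤ 1 / 2 := by
  rw [Real.rpow_neg_one, one_div]
  exact inv_anti₀ two_pos (by exact_mod_cast p.2.two_le)

theorem prime_rpow_neg_le_half {s : ℝ} (hs : 1 ≤ s) (p : Nat.Primes) :
    (p : ℝ) ^ (-s) ≤ 1 / 2 :=
  (prime_rpow_neg_le hs p).trans (prime_rpow_neg_one_le p)

theorem norm_neg_log_one_sub_sub_le {s : ℝ} (hs : 1 ≤ s) (p : Nat.Primes) :
    ‖-Real.log (1 - (p : ℝ) ^ (-s)) - (p : ℝ) ^ (-s)‖ ≤ 2 * (p : ℝ) ^ (-2 : ℝ) := by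
  have h := prime_rpow_neg_le_half hs p
  have hp : (0 : ℝ) ≤ p := Nat.cast_nonneg _
  rw [Real.norm_of_nonneg (neg_log_one_sub_sub_nonneg (by linarith))]
  refine (neg_log_one_sub_sub_le h).trans ?_
  have h2 : (p : ℝ) ^ (-2 : ℝ) = ((p : ℝ) ^ (-1 : ℝ)) ^ 2 := by
    rw [← Real.rpow_natCast, ← Real.rpow_mul hp]
    norm_num
  rw [h2]
  exact mul_le_mul_of_nonneg_left
    (pow_le_pow_left₀ (Real.rpow_nonneg hp _) (prime_rpow_neg_le hs p) 2) zero_le_two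

theorem summable_two_mul_prime_rpow : Summable fun p : Nat.Primes ↦ 2 * (p : ℝ) ^ (-2 : ℝ) :=
  (Nat.Primes.summable_rpow.2 (by norm_num)).mul_left 2

theorem summable_neg_log_one_sub_sub {s : ℝ} (hs : 1 ≤ s) :
    Summable fun p : Nat.Primes ↦ -Real.log (1 - (p : ℝ) ^ (-s)) - (p : ℝ) ^ (-s) :=
  Summable.of_norm_bounded summable_two_mul_prime_rpow (norm_neg_log_one_sub_sub_le hs)

theorem tendsto_tsum_neg_log_one_sub_sub :
    Tendsto (fun s : ℝ ↦ ∑' p : Nat.Primes, (-Real.log (1 - (p : ℝ) ^ (-s)) - (p : ℝ) ^ (-s)))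
      (𝓝[>] 1)
      (𝓝 (∑' p : Nat.Primes, (-Real.log (1 - (p : ℝ) ^ (-1 : ℝ)) - (p : ℝ) ^ (-1 : ℝ)))) := by
  refine tendsto_tsum_of_dominated_convergence summable_two_mul_prime_rpow (fun p ↦ ?_) ?_
  · have hp : (p : ℝ) ≠ 0 := by exact_mod_cast p.2.ne_zero
    have h1 : Tendsto (fun s : ℝ ↦ (p : ℝ) ^ (-s)) (𝓝[>] 1) (𝓝 ((p : ℝ) ^ (-1 : ℝ))) := by
      have : Continuous fun s : ℝ ↦ (p : ℝ) ^ (-s) :=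
        Real.continuous_const_rpow hp |>.comp continuous_neg
      exact (this.tendsto 1).mono_left nhdsWithin_le_nhds
    have h2 : 1 - (p : ℝ) ^ (-1 : ℝ) ≠ 0 := by linarith [prime_rpow_neg_one_le p]
    exact ((h1.const_sub 1).log h2).neg.sub h1
  · filter_upwards [self_mem_nhdsWithin] with s (hs : 1 < s)
    exact norm_neg_log_one_sub_sub_le hs.le

theorem tendsto_sum_primesLE_neg_log_one_sub_sub :
    Tendsto (fun n : ℕ ↦ ∑ p ∈ Nat.primesLE n, (-Real.log (1 - 1 / (p : ℝ)) - 1 / (p : ℝ))) atTop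
      (𝓝 (∑' p : Nat.Primes, (-Real.log (1 - (p : ℝ) ^ (-1 : ℝ)) - (p : ℝ) ^ (-1 : ℝ)))) := by
  have h := (summable_neg_log_one_sub_sub le_rfl).hasSum
  have h1 := (hasSum_subtype_iff_indicator (s := {p : ℕ | p.Prime})
    (f := fun n : ℕ ↦ -Real.log (1 - (n : ℝ) ^ (-1 : ℝ)) - (n : ℝ) ^ (-1 : ℝ))).1 h
  refine (h1.tendsto_sum_nat.comp (tendsto_add_atTop_nat 1)).congr fun n ↦ ?_
  rw [Nat.primesLE_eq_filter_range, Finset.sum_filter]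
  refine Finset.sum_congr rfl fun k _ ↦ ?_
  simp [indicator_apply, Real.rpow_neg_one]

theorem log_riemannZeta_eq_tsum {s : ℝ} (hs : 1 < s) :
    Real.log (riemannZeta s).re = ∑' p : Nat.Primes, (p : ℝ) ^ (-s) +
      ∑' p : Nat.Primes, (-Real.log (1 - (p : ℝ) ^ (-s)) - (p : ℝ) ^ (-s)) := by
  rw [← (Nat.Primes.summable_rpow.2 (by linarith)).tsum_add (summable_neg_log_one_sub_sub hs.le),
    ← riemannZeta_eulerProduct_exp_log (s := s) (by simpa using hs)]
  have h : ∀ p : Nat.Primes, -Complex.log (1 - (p : ℂ) ^ (-(s : ℂ))) =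
      ((-Real.log (1 - (p : ℝ) ^ (-s)) : ℝ) : ℂ) := fun p ↦ by
    rw [Complex.ofReal_neg, Complex.ofReal_log (by linarith [prime_rpow_neg_le_half hs.le p]),
      Complex.ofReal_sub, Complex.ofReal_cpow (Nat.cast_nonneg _)]
    simp
  simp_rw [h]
  rw [← Complex.ofReal_tsum, Complex.exp_ofReal_re, Real.log_exp]
  simp

theorem tendsto_primeDensity : Tendsto primeDensity atTop (𝓝 0) := by
  have h := tendsto_mul_primeDensity.mul tendsto_inv_atTop_zero
  rw [mul_zero] at h
  refine h.congr' ?_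
  filter_upwards [eventually_ne_atTop 0] with w hw
  field_simp

theorem tendsto_one_add_inv : Tendsto (fun u : ℝ ↦ 1 + u⁻¹) atTop (𝓝[>] 1) := by
  refine tendsto_nhdsWithin_iff.2 ⟨?_, ?_⟩
  · simpa using tendsto_inv_atTop_zero.const_add (1 : ℝ)
  · filter_upwards [eventually_gt_atTop 0] with u hu
    simpa using hu

theorem tendsto_log_riemannZeta_sub_log :
    Tendsto (fun u : ℝ ↦ Real.log (riemannZeta (1 + u⁻¹ : ℝ)).re - Real.log u) atTop (𝓝 0) := by
  have h := ((Asymptotics.isLittleO_one_iff ℝ).1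
    log_riemannZeta_add_log_sub_isLittleO_ofReal).comp tendsto_one_add_inv
  refine h.congr fun u ↦ ?_
  simp [sub_eq_add_neg]

theorem tendsto_tsum_primes_div :
    Tendsto (fun u : ℝ ↦ (∑' p : Nat.Primes, (p : ℝ) ^ (-(1 + u⁻¹))) / u) atTop (𝓝 0) := by
  have h1 := (tendsto_log_riemannZeta_sub_log.sub
    (tendsto_tsum_neg_log_one_sub_sub.comp tendsto_one_add_inv)).mul tendsto_inv_atTop_zero
  have h2 := h1.add Real.isLittleO_log_id_atTop.tendsto_div_nhds_zero
  rw [mul_zero, add_zero] at h2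
  refine h2.congr' ?_
  filter_upwards [eventually_gt_atTop 0] with u hu
  rw [log_riemannZeta_eq_tsum (by simpa using hu)]
  simp only [Function.comp, id]
  ring

theorem tendsto_sum_primesLE_one_div_sub_tsum :
    Tendsto (fun u : ℝ ↦ ∑ p ∈ Nat.primesLE ⌊Real.exp u⌋₊, 1 / (p : ℝ) -
      ∑' p : Nat.Primes, (p : ℝ) ^ (-(1 + u⁻¹))) atTop (𝓝 Real.eulerMascheroniConstant) := by
  obtain ⟨C, hC⟩ := exists_abs_mul_primeDensity_le
  have h1 := tendsto_integral_mul_exp_neg_div_sub measurable_primeDensity abs_primeDensity_le_one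
    hC tendsto_mul_primeDensity
  have h2 : Tendsto (fun u : ℝ ↦ (∑' p : Nat.Primes, (p : ℝ) ^ (-(1 + u⁻¹))) / u / (1 + u⁻¹))
      atTop (𝓝 0) := by
    have := tendsto_tsum_primes_div.div
      (tendsto_one_add_inv.mono_right nhdsWithin_le_nhds) one_ne_zero
    rwa [zero_div] at this
  have h3 := tendsto_primeDensity.sub (h1.add h2)
  rw [add_zero, zero_sub, neg_neg] at h3
  refine h3.congr' ?_
  filter_upwards [eventually_gt_atTop 0] with u hu
  have h4 : ∀ w : ℝ, -(w / u) = -u⁻¹ * w := fun w ↦ by ring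
  have h5 : 1 + u⁻¹ ≠ 0 := by positivity
  simp only [sum_primesLE_one_div, tsum_primes_rpow_neg (inv_pos.2 hu), h4]
  rw [div_right_comm, mul_div_cancel_left₀ _ h5]
  ring

/-- The third theorem of Mertens, in logarithmic form. -/
theorem tendsto_sum_primesLE_neg_log_sub_log :
    Tendsto (fun u : ℝ ↦ ∑ p ∈ Nat.primesLE ⌊Real.exp u⌋₊, -Real.log (1 - 1 / (p : ℝ)) -
      Real.log u) atTop (𝓝 Real.eulerMascheroniConstant) := by
  have h1 := tendsto_sum_primesLE_neg_log_one_sub_sub.comp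
    (tendsto_nat_floor_atTop.comp Real.tendsto_exp_atTop)
  have h2 := (tendsto_sum_primesLE_one_div_sub_tsum.add (h1.sub
    (tendsto_tsum_neg_log_one_sub_sub.comp tendsto_one_add_inv))).add
      tendsto_log_riemannZeta_sub_log
  rw [sub_self, add_zero, add_zero] at h2
  refine h2.congr' ?_
  filter_upwards [eventually_gt_atTop 0] with u hu
  rw [log_riemannZeta_eq_tsum (by simpa using hu)]
  simp only [Function.comp, Finset.sum_sub_distrib]
  ring

/-- The third theorem of Mertens. -/
theorem tendsto_inv_prod_primesLE_div_log :
    Tendsto (fun x : ℝ ↦ (∏ p ∈ Nat.primesLE ⌊x⌋₊, (1 - 1 / (p : ℝ)))⁻¹ / Real.log x) atTop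
      (𝓝 (Real.exp Real.eulerMascheroniConstant)) := by
  have h := ((Real.continuous_exp.tendsto _).comp
    tendsto_sum_primesLE_neg_log_sub_log).comp Real.tendsto_log_atTop
  refine h.congr' ?_
  filter_upwards [eventually_gt_atTop 1] with x hx
  have hpos : ∀ p ∈ Nat.primesLE ⌊x⌋₊, 0 < 1 - 1 / (p : ℝ) := fun p hp ↦ by
    have hp1 : (1 : ℝ) < p := by exact_mod_cast Nat.one_lt_of_mem_primesLE hp
    rw [sub_pos, div_lt_one (by linarith)]
    exact hp1
  simp only [Function.comp, Real.exp_log (zero_lt_one.trans hx), Real.exp_sub,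
    Real.exp_log (Real.log_pos hx), Finset.sum_neg_distrib, Real.exp_neg, Real.exp_sum]
  rw [Finset.prod_congr rfl fun p hp ↦ Real.exp_log (hpos p hp)]

theorem primesLE_nth_prime (n : ℕ) :
    Nat.primesLE (Nat.nth Nat.Prime n) = (Finset.range (n + 1)).image (Nat.nth Nat.Prime) := by
  ext p
  rw [Nat.mem_primesLE, Finset.mem_image]
  constructor
  · rintro ⟨hle, hp⟩
    have hnth := Nat.nth_count hp
    refine ⟨Nat.count Nat.Prime p, ?_, hnth⟩
    rw [← hnth, Nat.nth_le_nth Nat.infinite_setOfPred_prime] at hle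
    exact Finset.mem_range_succ_iff.2 hle
  · rintro ⟨i, hi, rfl⟩
    exact ⟨Nat.nth_monotone Nat.infinite_setOfPred_prime (Finset.mem_range_succ_iff.1 hi),
      Nat.prime_nth_prime i⟩

theorem prod_primesLE_nth_prime {M : Type*} [CommMonoid M] (f : ℕ → M) (n : ℕ) :
    ∏ p ∈ Nat.primesLE (Nat.nth Nat.Prime n), f p =
      ∏ i ∈ Finset.range (n + 1), f (Nat.nth Nat.Prime i) := by
  rw [primesLE_nth_prime,
    Finset.prod_image (Nat.nth_injective Nat.infinite_setOfPred_prime).injOn]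

theorem tendsto_nth_prime : Tendsto (fun n ↦ (Nat.nth Nat.Prime n : ℝ)) atTop atTop :=
  tendsto_natCast_atTop_atTop.comp
    (Nat.nth_strictMono Nat.infinite_setOfPred_prime).tendsto_atTop

theorem theta_nth_prime (n : ℕ) : Chebyshev.theta (Nat.nth Nat.Prime n) =
    ∑ i ∈ Finset.range (n + 1), Real.log (Nat.nth Nat.Prime i) := by
  rw [Chebyshev.theta, Nat.floor_natCast, ← Nat.primesLE_eq_filter_Ioc_zero, primesLE_nth_prime,
    Finset.sum_image (Nat.nth_injective Nat.infinite_setOfPred_prime).injOn]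

theorem tendsto_sum_log_nth_prime_div :
    Tendsto (fun n ↦ (∑ i ∈ Finset.range n, Real.log (Nat.nth Nat.Prime i)) /
      (Nat.nth Nat.Prime n : ℝ)) atTop (𝓝 1) := by
  have h := (tendsto_theta_div_id.sub Real.isLittleO_log_id_atTop.tendsto_div_nhds_zero).comp
    tendsto_nth_prime
  rw [sub_zero] at h
  refine h.congr fun n ↦ ?_
  simp only [Function.comp, id]
  rw [theta_nth_prime, Finset.sum_range_succ, ← sub_div, add_sub_cancel_right]

theorem tendsto_inv_prod_nth_prime_div_log :
    Tendsto (fun n ↦ (∏ i ∈ Finset.range (n + 1), (1 - 1 / (Nat.nth Nat.Prime i : ℝ)))⁻¹ /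
      Real.log (Nat.nth Nat.Prime n)) atTop (𝓝 (Real.exp Real.eulerMascheroniConstant)) := by
  refine (tendsto_inv_prod_primesLE_div_log.comp tendsto_nth_prime).congr fun n ↦ ?_
  simp only [Function.comp, Nat.floor_natCast]
  rw [prod_primesLE_nth_prime fun p ↦ 1 - 1 / (p : ℝ)]

theorem tendsto_sum_div_sum_of_tendsto_div {a b : ℕ → ℝ} {c : ℝ} (hb : ∀ n, 0 < b n)
    (hsum : Tendsto (fun n ↦ ∑ i ∈ Finset.range n, b i) atTop atTop)
    (h : Tendsto (fun n ↦ a n / b n) atTop (𝓝 c)) :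
    Tendsto (fun n ↦ (∑ i ∈ Finset.range n, a i) / ∑ i ∈ Finset.range n, b i) atTop (𝓝 c) := by
  have h1 : (fun n ↦ a n - c * b n) =o[atTop] b := by
    refine Asymptotics.isLittleO_of_tendsto (fun n hn ↦ absurd hn (hb n).ne') ?_
    have := h.sub_const c
    rw [sub_self] at this
    refine this.congr fun n ↦ ?_
    have := (hb n).ne'
    field_simp
  have h2 := (h1.sum_range (fun n ↦ (hb n).le) hsum).tendsto_div_nhds_zero.add_const c
  rw [zero_add] at h2
  refine h2.congr' ?_
  filter_upwards [hsum.eventually_gt_atTop 0] with n hn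
  rw [Finset.sum_sub_distrib, ← Finset.mul_sum]
  field_simp
  ring

theorem tendsto_sum_inv_prod_nth_prime_div :
    Tendsto (fun n ↦ (∑ j ∈ Finset.range n,
      (∏ i ∈ Finset.range (j + 1), (1 - 1 / (Nat.nth Nat.Prime i : ℝ)))⁻¹) /
      (Nat.nth Nat.Prime n : ℝ)) atTop (𝓝 (Real.exp Real.eulerMascheroniConstant)) := by
  have hlog : ∀ n, 0 < Real.log (Nat.nth Nat.Prime n) := fun n ↦
    Real.log_pos (by exact_mod_cast (Nat.prime_nth_prime n).one_lt)
  have hp : ∀ n, (0 : ℝ) < Nat.nth Nat.Prime n := fun n ↦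
    by exact_mod_cast (Nat.prime_nth_prime n).pos
  have hsum : Tendsto (fun n ↦ ∑ i ∈ Finset.range n, Real.log (Nat.nth Nat.Prime i)) atTop
      atTop := by
    refine (tendsto_sum_log_nth_prime_div.pos_mul_atTop one_pos tendsto_nth_prime).congr fun n ↦ ?_
    exact div_mul_cancel₀ _ (hp n).ne'
  have h := (tendsto_sum_div_sum_of_tendsto_div hlog hsum
    tendsto_inv_prod_nth_prime_div_log).mul tendsto_sum_log_nth_prime_div
  rw [mul_one] at h
  refine h.congr' ?_
  filter_upwards [hsum.eventually_gt_atTop 0] with n hn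
  exact div_mul_div_cancel₀ hn.ne'

/-- For the real primes the waiting-time form of the prime number theorem fails:
`p (n+1) / (2 + ∑_{j=1}^{n} 1/(d j)) → e^{-γ} ≠ 1`, where
`d j = ∏_{i=1}^{j} (1 - 1/(p i))` and `γ` is the Euler–Mascheroni constant. -/
theorem waiting_time_pnt_fails_for_primes :
    Filter.Tendsto
      (fun n : ℕ => (Nat.nth Nat.Prime n : ℝ) /
        (2 + ∑ j ∈ Finset.Icc 1 n,
          1 / ∏ i ∈ Finset.Icc 1 j, (1 - 1 / (Nat.nth Nat.Prime (i - 1) : ℝ))))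
      Filter.atTop (nhds (Real.exp (-Real.eulerMascheroniConstant))) ∧
    Real.exp (-Real.eulerMascheroniConstant) ≠ 1 := by
  constructor
  · have h := ((tendsto_nth_prime.const_div_atTop 2).add
      tendsto_sum_inv_prod_nth_prime_div).inv₀ (by simp [Real.exp_ne_zero])
    rw [zero_add, ← Real.exp_neg] at h
    refine h.congr fun n ↦ ?_
    have hIcc : ∀ m : ℕ, Finset.Icc 1 m = Finset.Ico 1 (m + 1) := fun m ↦ rfl
    simp only [hIcc, Finset.sum_Ico_eq_sum_range, Finset.prod_Ico_eq_prod_range,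
      Nat.add_sub_cancel, one_div, ← add_div, inv_div,
      Nat.add_comm 1]
  · rw [Ne, Real.exp_eq_one_iff, neg_eq_zero]
    exact (one_half_pos.trans Real.one_half_lt_eulerMascheroniConstant).ne'
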